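/- There exists p₀ such that for every prime p ≥ p₀ the following holds (with n = p² − 1 and t = n^{0.01}): for every A ∈ 𝒜_ord^long and every positive integer λ ≤ t/30, the map sending a pair (ε, (λ_{ij})_{1≤i<j≤5}), where ε ∈ {1, −1}, each λ_{ij} is an integer with |λ_{ij}| ≤ λ, and ∑_{i<j} λ_{ij} = 0, to the element ε·∏_{i<j} det(g_{ij}(A))^{λ_{ij}} of 𝔽_p^×, is injective. -/

import Mathlib

/-- Two vectors of `𝔽_p²` are collinear if one is a scalar multiple of the other. -/
def Coll (p : ℕ) (v w : Fin 2 → ZMod p) : Prop :=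
  ∃ c : ZMod p, w = c • v ∨ v = c • w

/-- `gmat p a b` is the 2×2 matrix over `𝔽_p` whose columns are `a` and `b`. -/
def gmat (p : ℕ) (a b : Fin 2 → ZMod p) : Matrix (Fin 2) (Fin 2) (ZMod p) :=
  Matrix.of fun i j => if j = 0 then a i else b i

/-- The set of off-diagonal index pairs `(i,j)`, `i ≠ j`, of `Fin 5`. -/
def offDiag5 : Finset (Fin 5 × Fin 5) :=
  Finset.univ.filter fun ij => ij.1 ≠ ij.2

/-- The set of index pairs `(i,j)` with `i < j` in `Fin 5`. -/
def underDiag5 : Finset (Fin 5 × Fin 5) :=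
  Finset.univ.filter fun ij => ij.1 < ij.2

/-- `𝒜_ord`: the set of 5-tuples of pairwise non-collinear vectors of `𝔽_p² ∖ {0}`
summing to `0`. -/
def AOrd (p : ℕ) : Set (Fin 5 → Fin 2 → ZMod p) :=
  {A | (∀ i, A i ≠ 0) ∧ (∑ i, A i) = 0 ∧ ∀ i j, i ≠ j → ¬ Coll p (A i) (A j)}

/-- A tuple of integers `(d_{ij})_{i≠j}` is a dependence if `∑_{i≠j} d_{ij} = 0`. -/
def IsDep (d : Fin 5 → Fin 5 → ℤ) : Prop :=
  ∑ ij ∈ offDiag5, d ij.1 ij.2 = 0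

/-- Twice the length of a dependence: `∑_{i<j} |d_{ij} + d_{ji}|`. -/
def depLen2 (d : Fin 5 → Fin 5 → ℤ) : ℤ :=
  ∑ ij ∈ underDiag5, |d ij.1 ij.2 + d ij.2 ij.1|

/-- The value `ω(A) = ∏_{i≠j} det(g_{ij}(A))^{d_{ij}}` of a dependence at a tuple `A`. -/
def omegaEval (p : ℕ) [Fact p.Prime] (d : Fin 5 → Fin 5 → ℤ)
    (A : Fin 5 → Fin 2 → ZMod p) : ZMod p :=
  ∏ ij ∈ offDiag5, (gmat p (A ij.1) (A ij.2)).det ^ (d ij.1 ij.2)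

/-- A dependence is trivial if `ω(A) = 1` for all `A ∈ 𝒜_ord`. -/
def TrivialDep (p : ℕ) [Fact p.Prime] (d : Fin 5 → Fin 5 → ℤ) : Prop :=
  ∀ A ∈ AOrd p, omegaEval p d A = 1

/-- `𝒜_ord^short`: tuples `A ∈ 𝒜_ord` satisfying a nontrivial dependence of length at most
`t = n^{0.01}` (with `n = p² - 1`). -/
def AOrdShort (p : ℕ) [Fact p.Prime] : Set (Fin 5 → Fin 2 → ZMod p) :=
  {A ∈ AOrd p | ∃ d : Fin 5 → Fin 5 → ℤ, IsDep d ∧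
    (depLen2 d : ℝ) ≤ 2 * ((p ^ 2 - 1 : ℕ) : ℝ) ^ (0.01 : ℝ) ∧
    ¬ TrivialDep p d ∧ omegaEval p d A = 1}

/-- `𝒜_ord^long = 𝒜_ord ∖ 𝒜_ord^short`. -/
def AOrdLong (p : ℕ) [Fact p.Prime] : Set (Fin 5 → Fin 2 → ZMod p) :=
  AOrd p \ AOrdShort p


open Polynomial in
/-- A multiplicative relation between `s`, `s + 2`, `1 - s` and a constant that holds on all of a
large finite field, poles and zeros excepted, does not involve `s`. -/
theorem exponent_eq_zero_of_forall_zpow_mul_eq_one {F : Type*} [Field F] [Fintype F]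
    (h2 : (2 : F) ≠ 0) {K : F} (hK : K ≠ 0) (a b c : ℤ)
    (hcard : |a| + |b| + |c| + 3 < (Fintype.card F : ℤ))
    (h : ∀ s : F, s ≠ 0 → s + 2 ≠ 0 → 1 - s ≠ 0 →
      s ^ a * (s + 2) ^ b * (1 - s) ^ c * K = 1) : a = 0 := by
  classical
  have key : ∀ (x : F) (k : ℤ), x ≠ 0 → x ^ k * x ^ (-k).toNat = x ^ k.toNat := by
    intro x k hx
    rw [← zpow_natCast, ← zpow_natCast, ← zpow_add₀ hx]
    congr 1
    omega
  set P : F[X] := C K * (X ^ a.toNat * (X + C 2) ^ b.toNat * (C 1 - X) ^ c.toNat) with hP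
  set Q : F[X] := X ^ (-a).toNat * (X + C 2) ^ (-b).toNat * (C 1 - X) ^ (-c).toNat with hQ
  have hdeg : ∀ i j k : ℕ,
      (X ^ i * (X + C (2 : F)) ^ j * (C 1 - X) ^ k : F[X]).natDegree ≤ i + j + k := by
    intro i j k
    compute_degree
  have hsub : (P - Q).natDegree ≤ (|a| + |b| + |c|).toNat := by
    refine (natDegree_sub_le _ _).trans (max_le ?_ ?_)
    · refine (natDegree_C_mul_le _ _).trans ((hdeg _ _ _).trans ?_)
      grind
    · refine (hdeg _ _ _).trans ?_
      grind
  have hPQ : P = Q := by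
    rw [← sub_eq_zero]
    refine eq_zero_of_natDegree_lt_card_of_eval_eq_zero' _
      (Finset.univ \ ({0, -2, 1} : Finset F)) ?_ ?_
    · intro s hs
      simp only [Finset.mem_sdiff, Finset.mem_univ, Finset.mem_insert, Finset.mem_singleton,
        true_and, not_or] at hs
      obtain ⟨h0, hm2, h1⟩ := hs
      have hs2 : s + 2 ≠ 0 := fun hh => hm2 (eq_neg_of_add_eq_zero_left hh)
      have hs1 : 1 - s ≠ 0 := fun hh => h1 (sub_eq_zero.mp hh).symm
      have hs := h s h0 hs2 hs1
      simp only [hP, hQ, eval_sub, eval_mul, eval_pow, eval_add, eval_X, eval_C]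
      rw [← key s a h0, ← key _ b hs2, ← key _ c hs1]
      linear_combination
        (s ^ (-a).toNat * (s + 2) ^ (-b).toNat * (1 - s) ^ (-c).toNat) * hs
    · have h3 : ({0, -2, 1} : Finset F).card ≤ 3 := Finset.card_le_three
      have := Finset.le_card_sdiff ({0, -2, 1} : Finset F) Finset.univ
      rw [Finset.card_univ] at this
      have := abs_nonneg a
      have := abs_nonneg b
      have := abs_nonneg c
      omega
  have h0 := congrArg (eval 0) hPQ
  simp only [hP, hQ, eval_sub, eval_mul, eval_pow, eval_add, eval_X, eval_C, zero_add, sub_zero,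
    one_pow, mul_one] at h0
  rcases lt_trichotomy a 0 with ha | ha | ha
  · rw [zero_pow (by omega : (-a).toNat ≠ 0), (by omega : a.toNat = 0)] at h0
    simp [hK, h2] at h0
  · exact ha
  · rw [zero_pow (by omega : a.toNat ≠ 0), (by omega : (-a).toNat = 0)] at h0
    simp only [zero_mul, mul_zero, pow_zero, one_mul] at h0
    exact absurd h0.symm (pow_ne_zero _ h2)

theorem prod_zpow_eq_zpow_sum {ι G₀ : Type*} [CommGroupWithZero G₀] {x : G₀} (hx : x ≠ 0)
    (s : Finset ι) (f : ι → ℤ) : ∏ i ∈ s, x ^ f i = x ^ ∑ i ∈ s, f i := by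
  classical
  induction s using Finset.induction_on with
  | empty => simp
  | insert i s hi ih => rw [Finset.prod_insert hi, Finset.sum_insert hi, zpow_add₀ hx, ih]

theorem det_gmat (p : ℕ) (v w : Fin 2 → ZMod p) :
    (gmat p v w).det = v 0 * w 1 - w 0 * v 1 := by
  simp [gmat, Matrix.det_fin_two]

theorem det_gmat_swap (p : ℕ) (v w : Fin 2 → ZMod p) :
    (gmat p w v).det = -(gmat p v w).det := by
  simp only [det_gmat]
  ring

theorem not_coll_iff_det_ne_zero (p : ℕ) [Fact p.Prime] (v w : Fin 2 → ZMod p) :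
    ¬ Coll p v w ↔ (gmat p v w).det ≠ 0 := by
  rw [not_iff_not, det_gmat]
  constructor
  · rintro ⟨c, rfl | rfl⟩ <;> simp only [Pi.smul_apply, smul_eq_mul] <;> ring
  · intro h
    by_cases h0 : v 0 = 0
    · by_cases h1 : v 1 = 0
      · refine ⟨0, Or.inr ?_⟩
        ext i
        fin_cases i <;> simp [h0, h1]
      · refine ⟨w 1 / v 1, Or.inl ?_⟩
        have hw : w 0 = 0 := by simpa [h0, h1] using h
        ext i
        fin_cases i <;> simp [h0, h1, hw]
    · refine ⟨w 0 / v 0, Or.inl ?_⟩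
      ext i
      fin_cases i
      · simp [h0]
      · simp only [Fin.mk_one, Pi.smul_apply, smul_eq_mul]
        field_simp
        linear_combination h

theorem mem_AOrd_of_det_ne_zero {p : ℕ} [Fact p.Prime] {A : Fin 5 → Fin 2 → ZMod p}
    (hsum : ∑ i, A i = 0) (hdet : ∀ ij ∈ underDiag5, (gmat p (A ij.1) (A ij.2)).det ≠ 0) :
    A ∈ AOrd p := by
  have hne : ∀ i j, i ≠ j → (gmat p (A i) (A j)).det ≠ 0 := by
    intro i j hij
    rcases lt_or_gt_of_ne hij with h | h
    · exact hdet (i, j) (by simpa [underDiag5] using h)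
    · rw [det_gmat_swap]
      exact neg_ne_zero.mpr (hdet (j, i) (by simpa [underDiag5] using h))
  refine ⟨fun i hi => ?_, hsum, fun i j hij => (not_coll_iff_det_ne_zero p _ _).mpr (hne i j hij)⟩
  obtain ⟨j, hj⟩ := exists_ne i
  exact hne i j hj.symm (by simp [det_gmat, hi])

theorem AOrd.comp_perm {p : ℕ} {A : Fin 5 → Fin 2 → ZMod p} (hA : A ∈ AOrd p)
    (σ : Equiv.Perm (Fin 5)) : A ∘ σ ∈ AOrd p :=
  ⟨fun i => hA.1 (σ i), (Equiv.sum_comp σ A).trans hA.2.1,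
    fun i j hij => hA.2.2 (σ i) (σ j) (σ.injective.ne hij)⟩

theorem TrivialDep.comp_perm {p : ℕ} [Fact p.Prime] {e : Fin 5 → Fin 5 → ℤ}
    (he : TrivialDep p e) (σ : Equiv.Perm (Fin 5)) :
    TrivialDep p fun i j => e (σ i) (σ j) := by
  intro A hA
  rw [← he _ (AOrd.comp_perm hA σ.symm)]
  refine Finset.prod_equiv (σ.prodCongr σ) (fun ij => ?_) fun ij _ => ?_
  · simp [offDiag5]
  · simp

theorem prod_offDiag5 {M : Type*} [CommMonoid M] (f : Fin 5 × Fin 5 → M) :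
    ∏ ij ∈ offDiag5, f ij = ∏ ij ∈ underDiag5, f ij * f ij.swap := by
  rw [Finset.prod_mul_distrib]
  have hdisj : Disjoint underDiag5 (underDiag5.map (Equiv.prodComm _ _).toEmbedding) := by decide
  have hunion : offDiag5 =
      underDiag5.disjUnion (underDiag5.map (Equiv.prodComm _ _).toEmbedding) hdisj := by
    clear f
    revert hdisj
    decide
  rw [hunion, Finset.prod_disjUnion, Finset.prod_map]
  rfl

theorem sum_offDiag5 {M : Type*} [AddCommMonoid M] (f : Fin 5 × Fin 5 → M) :
    ∑ ij ∈ offDiag5, f ij = ∑ ij ∈ underDiag5, (f ij + f ij.swap) :=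
  prod_offDiag5 (M := Multiplicative M) f

theorem omegaEval_of_symm {p : ℕ} [Fact p.Prime] {e : Fin 5 → Fin 5 → ℤ}
    (hsymm : ∀ i j, e i j = e j i) (A : Fin 5 → Fin 2 → ZMod p) :
    omegaEval p e A =
      ∏ ij ∈ underDiag5, (-(gmat p (A ij.1) (A ij.2)).det ^ 2) ^ e ij.1 ij.2 := by
  rw [omegaEval, prod_offDiag5]
  refine Finset.prod_congr rfl fun ij _ => ?_
  rw [Prod.fst_swap, Prod.snd_swap, hsymm ij.2 ij.1, det_gmat_swap, ← mul_zpow]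
  congr 1
  ring

theorem prod_underDiag5 {M : Type*} [CommMonoid M] (f : Fin 5 × Fin 5 → M) :
    ∏ ij ∈ underDiag5, f ij = f (0, 1) * f (0, 2) * f (0, 3) * f (0, 4) * f (1, 2) * f (1, 3) *
      f (1, 4) * f (2, 3) * f (2, 4) * f (3, 4) := by
  have h : underDiag5 = {(0, 1), (0, 2), (0, 3), (0, 4), (1, 2), (1, 3), (1, 4), (2, 3), (2, 4),
    (3, 4)} := by decide
  rw [h]
  simp [Finset.prod_insert, mul_assoc]

/-- A line of zero-sum tuples on which the first two vectors become collinear at `s = 0`, where all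
other pairs stay non-collinear. -/
def degeneratingTuple (p : ℕ) (s : ZMod p) : Fin 5 → Fin 2 → ZMod p :=
  ![![1, 0], ![1, s], ![0, 1], ![1, 1], ![-3, -(s + 2)]]

theorem TrivialDep.apply_zero_one_eq_zero {p : ℕ} [Fact p.Prime] {e : Fin 5 → Fin 5 → ℤ}
    (he : TrivialDep p e) (hsymm : ∀ i j, e i j = e j i) (N : ℤ)
    (hN : ∀ i j, i ≠ j → |e i j| ≤ N) (hp3 : 3 < p) (hp : 10 * N + 3 < p) : e 0 1 = 0 := by
  have h2 : (2 : ZMod p) ≠ 0 := by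
    intro h
    have := Nat.le_of_dvd (by norm_num) ((ZMod.natCast_eq_zero_iff 2 p).mp (by exact_mod_cast h))
    omega
  have h3 : (3 : ZMod p) ≠ 0 := by
    intro h
    have := Nat.le_of_dvd (by norm_num) ((ZMod.natCast_eq_zero_iff 3 p).mp (by exact_mod_cast h))
    omega
  have key := exponent_eq_zero_of_forall_zpow_mul_eq_one (F := ZMod p) h2
    (K := (-1) ^ (e 0 1 + e 0 2 + e 0 3 + e 0 4 + e 1 2 + e 1 3 + e 1 4 + e 2 3 + e 2 4 + e 3 4) *
      2 ^ (2 * e 1 4) * 3 ^ (2 * e 2 4)) (by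
      have h1 : (-1 : ZMod p) ≠ 0 := neg_ne_zero.mpr one_ne_zero
      exact mul_ne_zero (mul_ne_zero (zpow_ne_zero _ h1) (zpow_ne_zero _ h2)) (zpow_ne_zero _ h3))
    (2 * e 0 1) (2 * e 0 4) (2 * (e 1 3 + e 1 4 + e 3 4)) ?_ ?_
  · omega
  · rw [ZMod.card]
    have := hN 0 1 (by decide)
    have := hN 0 4 (by decide)
    have := hN 1 3 (by decide)
    have := hN 1 4 (by decide)
    have := hN 3 4 (by decide)
    grind
  · intro s hs0 hs2 hs1
    have hmem : degeneratingTuple p s ∈ AOrd p := by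
      refine mem_AOrd_of_det_ne_zero ?_ ?_
      · ext i
        fin_cases i <;> simp [degeneratingTuple, Fin.sum_univ_five] <;> ring
      · have hprod : ∏ ij ∈ underDiag5,
            (gmat p (degeneratingTuple p s ij.1) (degeneratingTuple p s ij.2)).det =
            -(2 * 3 * s * (s + 2) * (1 - s) ^ 3) := by
          rw [prod_underDiag5]
          simp only [det_gmat, degeneratingTuple]
          simp
          ring
        refine Finset.prod_ne_zero_iff.mp ?_
        rw [hprod]
        simp [h2, h3, hs0, hs1, hs2]
    have hone := he _ hmem
    rw [omegaEval_of_symm hsymm, prod_underDiag5] at hone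
    have hd : ∀ (x y : ZMod p) (k : ℤ), x ^ 2 = y ^ 2 →
        (-x ^ 2) ^ k = (-1) ^ k * y ^ (2 * k) := by
      intro x y k hxy
      rw [hxy, neg_eq_neg_one_mul, mul_zpow, zpow_mul]
      norm_cast
    rw [hd _ s, hd _ 1, hd _ 1, hd _ (s + 2), hd _ 1, hd _ (1 - s), hd _ (2 * (1 - s)), hd _ 1,
      hd _ 3, hd _ (1 - s)] at hone
    · refine Eq.trans ?_ hone
      have h1 : (-1 : ZMod p) ≠ 0 := neg_ne_zero.mpr one_ne_zero
      simp only [mul_add, zpow_add₀ h1, zpow_add₀ hs1, mul_zpow, one_zpow]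
      ring
    all_goals
      simp only [det_gmat, degeneratingTuple]
      simp
      try ring

/-- A symmetric trivial dependence with entries small compared to `p` vanishes. -/
theorem TrivialDep.eq_zero_of_symm {p : ℕ} [Fact p.Prime] {e : Fin 5 → Fin 5 → ℤ}
    (he : TrivialDep p e) (hsymm : ∀ i j, e i j = e j i) (N : ℤ)
    (hN : ∀ i j, i ≠ j → |e i j| ≤ N) (hp3 : 3 < p) (hp : 10 * N + 3 < p) {i j : Fin 5}
    (hij : i ≠ j) : e i j = 0 := by
  obtain ⟨σ, h0, h1⟩ : ∃ σ : Equiv.Perm (Fin 5), σ 0 = i ∧ σ 1 = j := by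
    have hne : Equiv.swap 0 i 1 ≠ i := by
      intro h
      have := (Equiv.swap (0 : Fin 5) i).injective (h.trans (Equiv.swap_apply_left 0 i).symm)
      exact absurd this (by decide)
    refine ⟨(Equiv.swap 0 i).trans (Equiv.swap (Equiv.swap 0 i 1) j), ?_, ?_⟩
    · rw [Equiv.trans_apply, Equiv.swap_apply_left, Equiv.swap_apply_of_ne_of_ne hne.symm hij]
    · rw [Equiv.trans_apply, Equiv.swap_apply_left]
  have := (he.comp_perm σ).apply_zero_one_eq_zero (fun _ _ => hsymm _ _) N
    (fun k l hkl => hN _ _ (σ.injective.ne hkl)) hp3 hp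
  rwa [h0, h1] at this

theorem rpow_add_three_lt {p : ℕ} (hp : 100 ≤ p) :
    ((p ^ 2 - 1 : ℕ) : ℝ) ^ (0.01 : ℝ) + 3 < p := by
  have hp' : (100 : ℝ) ≤ p := by exact_mod_cast hp
  have hle : ((p ^ 2 - 1 : ℕ) : ℝ) ≤ (p : ℝ) ^ (2 : ℝ) := by
    rw [Real.rpow_two]
    exact_mod_cast Nat.sub_le _ _
  have h1 : ((p ^ 2 - 1 : ℕ) : ℝ) ^ (0.01 : ℝ) ≤ √p := by
    refine (Real.rpow_le_rpow (Nat.cast_nonneg _) hle (by norm_num)).trans ?_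
    rw [← Real.rpow_mul (by positivity), Real.sqrt_eq_rpow]
    exact Real.rpow_le_rpow_of_exponent_le (by linarith) (by norm_num)
  have h2 : 10 ≤ √(p : ℝ) := Real.le_sqrt_of_sq_le (by linarith)
  nlinarith [Real.mul_self_sqrt (show (0 : ℝ) ≤ p by linarith)]

/-- There exists `p₀` such that for every prime `p ≥ p₀` (with `n = p² - 1`, `t = n^{0.01}`):
for every `A ∈ 𝒜_ord^long` and every positive integer `λ ≤ t/30`, the map sending
`(ε, (λ_{ij})_{i<j})` with `ε ∈ {1, -1}`, `|λ_{ij}| ≤ λ` and `∑_{i<j} λ_{ij} = 0` to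
`ε · ∏_{i<j} det(g_{ij}(A))^{λ_{ij}} ∈ 𝔽_p^×` is injective. -/
theorem stmt12 :
    ∃ p₀ : ℕ, ∀ (p : ℕ) [Fact p.Prime], p₀ ≤ p →
      ∀ A ∈ AOrdLong p, ∀ lam : ℕ, 0 < lam →
        ((lam : ℝ) ≤ ((p ^ 2 - 1 : ℕ) : ℝ) ^ (0.01 : ℝ) / 30) →
        ∀ ε₁ ε₂ : ZMod p, (ε₁ = 1 ∨ ε₁ = -1) → (ε₂ = 1 ∨ ε₂ = -1) →
        ∀ μ ν : Fin 5 → Fin 5 → ℤ,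
          (∀ ij ∈ underDiag5, |μ ij.1 ij.2| ≤ (lam : ℤ)) →
          (∑ ij ∈ underDiag5, μ ij.1 ij.2 = 0) →
          (∀ ij ∈ underDiag5, |ν ij.1 ij.2| ≤ (lam : ℤ)) →
          (∑ ij ∈ underDiag5, ν ij.1 ij.2 = 0) →
          ε₁ * ∏ ij ∈ underDiag5, (gmat p (A ij.1) (A ij.2)).det ^ (μ ij.1 ij.2)
            = ε₂ * ∏ ij ∈ underDiag5, (gmat p (A ij.1) (A ij.2)).det ^ (ν ij.1 ij.2) →
          ε₁ = ε₂ ∧ ∀ ij ∈ underDiag5, μ ij.1 ij.2 = ν ij.1 ij.2 := by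
  refine ⟨100, ?_⟩
  intro p _ hp A hA lam _ hlam ε₁ ε₂ hε₁ hε₂ μ ν hμ hμ0 hν hν0 heq
  obtain ⟨hAO, hAS⟩ := hA
  have hdet : ∀ ij ∈ underDiag5, (gmat p (A ij.1) (A ij.2)).det ≠ 0 := fun ij hij =>
    (not_coll_iff_det_ne_zero p _ _).mp
      (hAO.2.2 _ _ (Finset.mem_filter.mp hij).2.ne)
  set e : Fin 5 → Fin 5 → ℤ := fun i j =>
    μ (min i j) (max i j) - ν (min i j) (max i j) with he
  have hsymm : ∀ i j, e i j = e j i := fun i j => by simp only [he, min_comm, max_comm]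
  have hunder : ∀ ij ∈ underDiag5, e ij.1 ij.2 = μ ij.1 ij.2 - ν ij.1 ij.2 := fun ij hij => by
    have := (Finset.mem_filter.mp hij).2.le
    simp only [he, min_eq_left this, max_eq_right this]
  have hbound_under : ∀ ij ∈ underDiag5, |e ij.1 ij.2| ≤ 2 * (lam : ℤ) := fun ij hij => by
    rw [hunder ij hij]
    have := hμ ij hij
    have := hν ij hij
    grind
  have hbound : ∀ i j, i ≠ j → |e i j| ≤ 2 * (lam : ℤ) := fun i j hij => by
    rcases lt_or_gt_of_ne hij with h | h
    · exact hbound_under (i, j) (by simpa [underDiag5] using h)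
    · rw [hsymm]
      exact hbound_under (j, i) (by simpa [underDiag5] using h)
  have hsum : ∑ ij ∈ underDiag5, e ij.1 ij.2 = 0 := by
    rw [Finset.sum_congr rfl hunder, Finset.sum_sub_distrib, hμ0, hν0, sub_zero]
  have hdep : IsDep e := by
    rw [IsDep, sum_offDiag5, Finset.sum_add_distrib, hsum, zero_add, ← hsum]
    exact Finset.sum_congr rfl fun ij _ => hsymm _ _
  have hlen : depLen2 e ≤ 40 * (lam : ℤ) := by
    have : depLen2 e ≤ ∑ _ij ∈ underDiag5, 4 * (lam : ℤ) := by
      refine Finset.sum_le_sum fun ij hij => ?_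
      have := hbound_under ij hij
      rw [← hsymm ij.1 ij.2]
      grind
    have hc : underDiag5.card = 10 := by decide
    rw [Finset.sum_const, hc, nsmul_eq_mul] at this
    push_cast at this
    linarith
  have hprod : (∏ ij ∈ underDiag5, (gmat p (A ij.1) (A ij.2)).det ^ e ij.1 ij.2) ^ 2 = 1 := by
    have hsplit : ∏ ij ∈ underDiag5, (gmat p (A ij.1) (A ij.2)).det ^ e ij.1 ij.2 =
        (∏ ij ∈ underDiag5, (gmat p (A ij.1) (A ij.2)).det ^ μ ij.1 ij.2) /
          ∏ ij ∈ underDiag5, (gmat p (A ij.1) (A ij.2)).det ^ ν ij.1 ij.2 := by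
      rw [← Finset.prod_div_distrib]
      exact Finset.prod_congr rfl fun ij hij => by rw [hunder ij hij, zpow_sub₀ (hdet ij hij)]
    have hν_ne : ∏ ij ∈ underDiag5, (gmat p (A ij.1) (A ij.2)).det ^ ν ij.1 ij.2 ≠ 0 :=
      Finset.prod_ne_zero_iff.mpr fun ij hij => zpow_ne_zero _ (hdet ij hij)
    rw [hsplit, div_pow, div_eq_one_iff_eq (pow_ne_zero 2 hν_ne)]
    have := congrArg (· ^ 2) heq
    simp only [mul_pow] at this
    rwa [sq_eq_one_iff.mpr hε₁, sq_eq_one_iff.mpr hε₂, one_mul, one_mul] at this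
  have homega : omegaEval p e A = 1 := by
    have hneg : ∏ ij ∈ underDiag5, (-1 : ZMod p) ^ e ij.1 ij.2 = 1 := by
      rw [prod_zpow_eq_zpow_sum (neg_ne_zero.mpr one_ne_zero), hsum, zpow_zero]
    rw [omegaEval_of_symm hsymm, ← hprod, ← Finset.prod_pow,
      ← one_mul (∏ ij ∈ underDiag5, _ ^ 2), ← hneg, ← Finset.prod_mul_distrib]
    refine Finset.prod_congr rfl fun ij _ => ?_
    rw [neg_eq_neg_one_mul, mul_zpow, ← zpow_natCast, ← zpow_natCast, ← zpow_mul, ← zpow_mul,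
      mul_comm ((2 : ℕ) : ℤ)]
  have hlt := rpow_add_three_lt hp
  have htriv : TrivialDep p e := by
    by_contra hnt
    refine hAS ⟨hAO, e, hdep, ?_, hnt, homega⟩
    have : (depLen2 e : ℝ) ≤ 40 * lam := by exact_mod_cast hlen
    have : (0 : ℝ) ≤ lam := Nat.cast_nonneg _
    linarith
  have hsmall : 10 * (2 * (lam : ℤ)) + 3 < p := by
    have h0 : (0 : ℝ) ≤ lam := Nat.cast_nonneg _
    have : (10 * (2 * (lam : ℝ)) + 3 : ℝ) < p := by linarith
    exact_mod_cast this
  have hμν : ∀ ij ∈ underDiag5, μ ij.1 ij.2 = ν ij.1 ij.2 := fun ij hij => by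
    have := htriv.eq_zero_of_symm hsymm _ hbound (by omega) hsmall
      (Finset.mem_filter.mp hij).2.ne
    rw [hunder ij hij] at this
    exact sub_eq_zero.mp this
  refine ⟨?_, hμν⟩
  rw [Finset.prod_congr rfl fun ij hij => by rw [hμν ij hij]] at heq
  exact mul_right_cancel₀
    (Finset.prod_ne_zero_iff.mpr fun ij hij => zpow_ne_zero _ (hdet ij hij)) heq
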